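/- arXiv:1407.8460 — 2 statements merged into one kernel-verified Lean document; each statement's English description precedes it below -/
import Mathlib

section
/- Let d ≥ 1, L_0 ≥ 1, n ≥ 1, x ∈ 𝓛_n = L_n ℤ^d, and let 𝒯 ∈ Λ_{n,x} be a proper embedding of T_n. Then for every leaf m ∈ T_{(n)}, every k ≥ 1, every m' ∈ T_{(n)}^{m,k}, every y ∈ S(𝒯(m), L_0 − 1) and every z ∈ S(𝒯(m'), L_0 − 1), one has |y − z| ≥ L_{k−1}. -/
/-- The ℓ∞-norm on `ℤ^d`. -/
def linf {d : ℕ} (x : Fin d → ℤ) : ℤ := ((Finset.univ.sup fun i => (x i).natAbs : ℕ) : ℤ)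

/-- The ℓ∞-sphere `S(x,R)` in `ℤ^d`. -/
def sphereZ {d : ℕ} (x : Fin d → ℤ) (R : ℤ) : Set (Fin d → ℤ) := {y | linf (y - x) = R}

/-- The lattice `L ℤ^d`. -/
def lattice (d : ℕ) (L : ℤ) : Set (Fin d → ℤ) := {x | ∀ i, L ∣ x i}

/-- The scales `L_j = L_0 · 6^j`. -/
def Ln (L0 : ℤ) (j : ℕ) : ℤ := L0 * 6 ^ j

/-- Vertices of the dyadic tree `T_n`: sequences over `{1,2}` (here `Bool`)
of length at most `n`; the length is the depth of the vertex. -/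
def TreeVert (n : ℕ) := {l : List Bool // l.length ≤ n}

/-- `𝒯` is a proper embedding of `T_n` into `ℤ^d` with root at `x`:
(1) the root is mapped to `x`; (2) a vertex at depth `k` is mapped into `𝓛_{n-k}`;
(3) for a vertex `m` at depth `k < n`, its first child (append `false`) is at
ℓ∞-distance `L_{n-k}` from `m` and its second child (append `true`) is at
ℓ∞-distance `2 L_{n-k}` from `m`. -/
def ProperEmbedding (d n : ℕ) (L0 : ℤ) (x : Fin d → ℤ)
    (T : TreeVert n → (Fin d → ℤ)) : Prop :=
  T ⟨[], by simp⟩ = x ∧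
  (∀ (l : List Bool) (h : l.length ≤ n),
    T ⟨l, h⟩ ∈ lattice d (Ln L0 (n - l.length))) ∧
  (∀ (l : List Bool) (h : l.length < n),
    linf (T ⟨l ++ [false], by simpa using h⟩ - T ⟨l, h.le⟩) = Ln L0 (n - l.length) ∧
    linf (T ⟨l ++ [true], by simpa using h⟩ - T ⟨l, h.le⟩) = 2 * Ln L0 (n - l.length))

/-- `Λ_{n,x}`, the set of proper embeddings of `T_n` with root at `x`. -/
def Lambda (d n : ℕ) (L0 : ℤ) (x : Fin d → ℤ) : Set (TreeVert n → (Fin d → ℤ)) :=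
  {T | ProperEmbedding d n L0 x T}

/-- The lexicographic distance `ρ(m,m')` of two leaves of `T_n`:
the least `k ≥ 0` such that the truncations of `m` and `m'` to their
first `n - k` coordinates agree. -/
noncomputable def rho (n : ℕ) (m m' : List Bool) : ℕ :=
  sInf {k | m.take (n - k) = m'.take (n - k)}

lemma linf_triangle {d : ℕ} (a b c : Fin d → ℤ) :
    linf (a - c) ≤ linf (a - b) + linf (b - c) := by
  unfold linf
  norm_cast
  refine Finset.sup_le fun i _ => ?_
  have h₁ := Finset.le_sup (f := fun i => ((a - b) i).natAbs) (Finset.mem_univ i)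
  have h₂ := Finset.le_sup (f := fun i => ((b - c) i).natAbs) (Finset.mem_univ i)
  simp only [Pi.sub_apply] at h₁ h₂ ⊢
  omega

lemma linf_sub_comm {d : ℕ} (a b : Fin d → ℤ) : linf (a - b) = linf (b - a) := by
  rw [← neg_sub b a]
  simp only [linf, Pi.neg_apply, Int.natAbs_neg]

/-- The distance from a vertex to its child with label `b`. -/
lemma ProperEmbedding.linf_child_sub {d n : ℕ} {L0 : ℤ} {x : Fin d → ℤ}
    {T : TreeVert n → (Fin d → ℤ)} (hT : ProperEmbedding d n L0 x T) {v w : TreeVert n}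
    {b : Bool} (h : w.1 = v.1 ++ [b]) :
    linf (T w - T v) = (if b then 2 else 1) * Ln L0 (n - v.1.length) := by
  obtain ⟨l, hl⟩ := v
  obtain ⟨l', hl'⟩ := w
  obtain rfl : l' = l ++ [b] := h
  have hlt : l.length < n := by simpa using hl'
  have := hT.2.2 l hlt
  cases b <;> simp [this.1, this.2]

/-- The truncation of a vertex to its first `j` coordinates. -/
def TreeVert.take {n : ℕ} (v : TreeVert n) (j : ℕ) : TreeVert n :=
  ⟨v.1.take j, (List.length_take_le' j v.1).trans v.2⟩

lemma TreeVert.take_succ {n : ℕ} (v : TreeVert n) {j : ℕ} (hj : j < v.1.length) :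
    (v.take (j + 1)).1 = (v.take j).1 ++ [v.1[j]] :=
  List.take_succ_eq_append_getElem hj

/-- A leaf stays close to its ancestor `j` generations up. -/
lemma ProperEmbedding.linf_sub_take_le {d n : ℕ} {L0 : ℤ} (hL0 : 0 ≤ L0) {x : Fin d → ℤ}
    {T : TreeVert n → (Fin d → ℤ)} (hT : ProperEmbedding d n L0 x T) {v : TreeVert n}
    (hv : v.1.length = n) {j : ℕ} (hj : j ≤ n) :
    5 * linf (T v - T (v.take (n - j))) ≤ 2 * (Ln L0 (j + 1) - 6 * L0) := by
  induction j with
  | zero =>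
    have : v.take (n - 0) = v := Subtype.ext (List.take_of_length_le (by omega))
    have hzero : linf (0 : Fin d → ℤ) = 0 := by
      simp only [linf, Pi.zero_apply, Int.natAbs_zero]
      exact_mod_cast Finset.sup_bot _
    rw [this, sub_self, hzero]
    simp [Ln, mul_comm]
  | succ j ih =>
    have hlt : n - (j + 1) < v.1.length := by omega
    have hchild := hT.linf_child_sub (v.take_succ hlt)
    have hlen : (v.take (n - (j + 1))).1.length = n - (j + 1) := by
      simp only [TreeVert.take, List.length_take]; omega
    rw [hlen, show n - (j + 1) + 1 = n - j by omega,
      show n - (n - (j + 1)) = j + 1 by omega] at hchild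
    have htri := linf_triangle (T v) (T (v.take (n - j))) (T (v.take (n - (j + 1))))
    have hpos : 0 ≤ Ln L0 (j + 1) := by unfold Ln; positivity
    have hstep : Ln L0 (j + 1 + 1) = 6 * Ln L0 (j + 1) := by unfold Ln; ring
    have := ih (by omega)
    split_ifs at hchild <;> linarith

/-- Two distinct children of the same vertex at depth `n - k` are `L_k`-separated. -/
lemma ProperEmbedding.le_linf_sub_of_siblings {d n : ℕ} {L0 : ℤ} {x : Fin d → ℤ}
    {T : TreeVert n → (Fin d → ℤ)} (hT : ProperEmbedding d n L0 x T) {u v w : TreeVert n}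
    {b c : Bool} (hv : v.1 = u.1 ++ [b]) (hw : w.1 = u.1 ++ [c]) (hbc : b ≠ c) :
    Ln L0 (n - u.1.length) ≤ linf (T v - T w) := by
  have h₁ := hT.linf_child_sub hv
  have h₂ := hT.linf_child_sub hw
  have h₃ := linf_triangle (T v) (T w) (T u)
  have h₄ := linf_triangle (T w) (T v) (T u)
  rw [linf_sub_comm (T w) (T v)] at h₄
  cases b <;> cases c <;> simp at hbc h₁ h₂ <;> linarith

lemma rho_le (n : ℕ) (m m' : List Bool) : rho n m m' ≤ n := Nat.sInf_le (by simp)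

lemma take_sub_rho (n : ℕ) (m m' : List Bool) :
    m.take (n - rho n m m') = m'.take (n - rho n m m') :=
  Nat.sInf_mem (s := {k | m.take (n - k) = m'.take (n - k)}) ⟨n, by simp⟩

lemma take_sub_ne_of_lt_rho {n k : ℕ} {m m' : List Bool} (h : k < rho n m m') :
    m.take (n - k) ≠ m'.take (n - k) :=
  Nat.notMem_of_lt_sInf h

/-- a proper embedding is spread-out on all scales: if `m, m'` are
leaves with `ρ(m,m') = k ≥ 1`, then any `y ∈ S(𝒯(m), L_0 - 1)` and
`z ∈ S(𝒯(m'), L_0 - 1)` satisfy `|y - z| ≥ L_{k-1}`. -/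
theorem proper_embedding_spread_out (d : ℕ) (hd : 1 ≤ d) (L0 : ℤ) (hL0 : 1 ≤ L0)
    (n : ℕ) (hn : 1 ≤ n) (x : Fin d → ℤ) (hx : x ∈ lattice d (Ln L0 n))
    (T : TreeVert n → (Fin d → ℤ)) (hT : T ∈ Lambda d n L0 x)
    (m m' : List Bool) (hm : m.length = n) (hm' : m'.length = n)
    (k : ℕ) (hk : 1 ≤ k) (hρ : rho n m m' = k)
    (y z : Fin d → ℤ)
    (hy : y ∈ sphereZ (T ⟨m, hm.le⟩) (L0 - 1))
    (hz : z ∈ sphereZ (T ⟨m', hm'.le⟩) (L0 - 1)) :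
    Ln L0 (k - 1) ≤ linf (y - z) := by
  obtain ⟨j, rfl⟩ : ∃ j, k = j + 1 := ⟨k - 1, by omega⟩
  have hT : ProperEmbedding d n L0 x T := hT
  have hjn : j + 1 ≤ n := hρ ▸ rho_le n m m'
  have heq := take_sub_rho n m m'
  rw [hρ] at heq
  have hne := take_sub_ne_of_lt_rho (show j < rho n m m' by omega)
  set v : TreeVert n := ⟨m, hm.le⟩
  set v' : TreeVert n := ⟨m', hm'.le⟩
  have hlt : n - (j + 1) < v.1.length := by simp only [v]; omega
  have hlt' : n - (j + 1) < v'.1.length := by simp only [v']; omega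
  have hchild := v.take_succ hlt
  have hchild' := v'.take_succ hlt'
  have hanc : v.take (n - (j + 1)) = v'.take (n - (j + 1)) := Subtype.ext heq
  rw [← hanc] at hchild'
  rw [show n - (j + 1) + 1 = n - j by omega] at hchild hchild'
  have hlen : (v.take (n - (j + 1))).1.length = n - (j + 1) := by
    simp only [TreeVert.take, List.length_take]; omega
  have hsib := hT.le_linf_sub_of_siblings hchild hchild' fun h =>
    hne (show (v.take (n - j)).1 = (v'.take (n - j)).1 by rw [hchild, hchild', h])
  rw [hlen, show n - (n - (j + 1)) = j + 1 by omega] at hsib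
  have hdesc := hT.linf_sub_take_le (by omega) (v := v) hm (j := j) (by omega)
  have hdesc' := hT.linf_sub_take_le (by omega) (v := v') hm' (j := j) (by omega)
  have hy : linf (y - T v) = L0 - 1 := hy
  have hz : linf (z - T v') = L0 - 1 := hz
  have h₁ := linf_triangle (T (v.take (n - j))) (T v) (T (v'.take (n - j)))
  have h₂ := linf_triangle (T v) (T v') (T (v'.take (n - j)))
  have h₃ := linf_triangle (T v) y (T v')
  have h₄ := linf_triangle y z (T v')
  rw [linf_sub_comm _ (T v)] at h₁
  rw [linf_sub_comm _ y] at h₃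
  have hstep : Ln L0 (j + 1) = 6 * Ln L0 j := by unfold Ln; ring
  have hpos : 0 ≤ Ln L0 j := by unfold Ln; positivity
  rw [Nat.add_sub_cancel]
  linarith
end

section
/- For any integers d ≥ 1 and L ≥ 1, the ℓ∞-sphere S(0, 7L − 1) in ℤ^d is contained in the union of the spheres S(y, L − 1) over all y ∈ S(0, 6L) ∩ Lℤ^d. -/
theorem linf_eq_of_forall_le_of_eq {d : ℕ} {x : Fin d → ℤ} {R : ℤ}
    (hle : ∀ i, |x i| ≤ R) {i : Fin d} (hi : |x i| = R) : linf x = R := by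
  simp only [Int.abs_eq_natAbs] at hle hi
  unfold linf
  have hupper : (Finset.univ.sup fun i => (x i).natAbs) ≤ R.natAbs :=
    Finset.sup_le fun j _ => by have := hle j; omega
  have hlower : (x i).natAbs ≤ Finset.univ.sup fun i => (x i).natAbs :=
    Finset.le_sup (f := fun i => (x i).natAbs) (Finset.mem_univ i)
  omega

theorem abs_le_linf {d : ℕ} (x : Fin d → ℤ) (i : Fin d) : |x i| ≤ linf x := by
  have h : (x i).natAbs ≤ Finset.univ.sup fun i => (x i).natAbs :=
    Finset.le_sup (f := fun i => (x i).natAbs) (Finset.mem_univ i)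
  unfold linf
  rw [Int.abs_eq_natAbs]
  omega

theorem exists_abs_eq_linf {d : ℕ} (hd : 1 ≤ d) (x : Fin d → ℤ) : ∃ i, |x i| = linf x := by
  have : Nonempty (Fin d) := ⟨⟨0, hd⟩⟩
  obtain ⟨i, -, hi⟩ := Finset.exists_mem_eq_sup Finset.univ Finset.univ_nonempty
    fun i => (x i).natAbs
  refine ⟨i, ?_⟩
  unfold linf
  rw [hi, Int.natCast_natAbs]

/-- Rounding towards zero to a multiple of `L`. -/
theorem exists_dvd_abs_le_of_abs_le {L a k : ℤ} (hL : 1 ≤ L) (ha : |a| ≤ (k + 1) * L - 1) :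
    ∃ b, L ∣ b ∧ |b| ≤ k * L ∧ |a - b| ≤ L - 1 ∧
      (|a| = (k + 1) * L - 1 → |b| = k * L ∧ |a - b| = L - 1) := by
  wlog h : 0 ≤ a generalizing a
  · obtain ⟨b, hdvd, hb, hab, heq⟩ := this (a := -a) (by rwa [abs_neg]) (by omega)
    refine ⟨-b, (dvd_neg).2 hdvd, by rwa [abs_neg], ?_, ?_⟩
    · rw [← abs_neg]; convert hab using 2; ring
    · rw [abs_neg] at heq
      rw [abs_neg, ← abs_neg (a - -b), show -(a - -b) = -a - b by ring]
      exact heq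
  rw [abs_of_nonneg h] at ha ⊢
  have hdiv := Int.emod_add_mul_ediv a L
  have hmod := Int.emod_nonneg a (by omega : L ≠ 0)
  have hlt := Int.emod_lt_of_pos a (by omega : 0 < L)
  have hq : 0 ≤ L * (a / L) := mul_nonneg (by omega) (Int.ediv_nonneg h (by omega))
  have hqk : a / L ≤ k := by
    have : a / L < k + 1 := Int.ediv_lt_of_lt_mul (by omega) (by omega)
    omega
  have hmul : L * (a / L) ≤ k * L := by
    rw [mul_comm k]; exact mul_le_mul_of_nonneg_left hqk (by omega)
  rw [add_mul, one_mul] at ha ⊢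
  refine ⟨L * (a / L), dvd_mul_right _ _, ?_, ?_, ?_⟩
  · rwa [abs_of_nonneg hq]
  · rw [abs_of_nonneg (by omega)]; omega
  · intro h'
    rw [abs_of_nonneg hq, abs_of_nonneg (by omega)]
    omega

/-- for `d ≥ 1` and `L ≥ 1`, the ℓ∞-sphere `S(0, 7L - 1)` in `ℤ^d`
is covered by the spheres `S(y, L - 1)` with `y ∈ S(0, 6L) ∩ L ℤ^d`. -/
theorem sphere_seven_covered (d : ℕ) (hd : 1 ≤ d) (L : ℤ) (hL : 1 ≤ L) :
    sphereZ (0 : Fin d → ℤ) (7 * L - 1) ⊆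
      ⋃ y ∈ sphereZ (0 : Fin d → ℤ) (6 * L) ∩ lattice d L, sphereZ y (L - 1) := by
  intro x hx
  have hx' : linf x = 7 * L - 1 := by simpa [sphereZ] using hx
  choose y hdvd hy hxy heq using fun i =>
    exists_dvd_abs_le_of_abs_le (a := x i) (k := 6) hL
      ((abs_le_linf x i).trans (by rw [hx']; norm_num))
  obtain ⟨i, hi⟩ := exists_abs_eq_linf hd x
  obtain ⟨hyi, hxyi⟩ := heq i (by rw [hi, hx']; norm_num)
  refine Set.mem_biUnion (x := y) ⟨?_, hdvd⟩ ?_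
  · change linf (y - 0) = 6 * L
    rw [sub_zero]
    exact linf_eq_of_forall_le_of_eq hy hyi
  · exact linf_eq_of_forall_le_of_eq (x := x - y) hxy hxyi
end
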